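/- Let (H, blocks, ε, π_1, π_2, π_3) be a connected CTKT stranded graph all of whose vertices are tetrahedral (V_p = V_d = 0), with V_t vertices and F total faces. If the graph contains a face of length one, i.e. there exist a half-edge h and a color c with ε(h) = π_c(h), then 2·F ≤ 5 + 3·V_t; in other words, its CTKT degree ω := 3 + (3/2)·V_t − F satisfies ω ≥ 1/2. -/

import Mathlib

open Module

/-- Rational functions on `H` that are invariant under the permutation `a`. -/
def invariantFunctions {H : Type*} (a : Equiv.Perm H) : Submodule ℚ (H → ℚ) where
  carrier := {f | ∀ h, f (a h) = f h}
  add_mem' hf hg h := by simp [hf h, hg h]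
  zero_mem' _ := rfl
  smul_mem' c f hf h := by simp [hf h]

/-- Rational functions on `H` that change sign under each of the permutations `a`, `b`, `e`. -/
def antiInvariantFunctions {H : Type*} (a b e : Equiv.Perm H) : Submodule ℚ (H → ℚ) where
  carrier := {f | ∀ h, f (a h) = -f h ∧ f (b h) = -f h ∧ f (e h) = -f h}
  add_mem' hf hg h := by
    obtain ⟨h₁, h₂, h₃⟩ := hf h
    obtain ⟨k₁, k₂, k₃⟩ := hg h
    simp only [Pi.add_apply, h₁, h₂, h₃, k₁, k₂, k₃]
    refine ⟨?_, ?_, ?_⟩ <;> ring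
  zero_mem' _ := by simp
  smul_mem' c f hf h := by
    obtain ⟨h₁, h₂, h₃⟩ := hf h
    simp [h₁, h₂, h₃]

/-- The orbits of the group generated by two permutations. -/
abbrev PairOrbits {H : Type*} (a b : Equiv.Perm H) : Type _ :=
  MulAction.orbitRel.Quotient (Subgroup.closure {a, b} : Subgroup (Equiv.Perm H)) H

lemma two_mul_finrank_invariantFunctions_le {H : Type*} [Fintype H] (a : Equiv.Perm H)
    (ha : ∀ h, a (a h) = h) (ha' : ∀ h, a h ≠ h) :
    2 * finrank ℚ (invariantFunctions a) ≤ Fintype.card H := by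
  classical
  let i := Fintype.equivFin H
  let T : Finset H := Finset.univ.filter fun h => i h < i (a h)
  have hT : 2 * T.card ≤ Fintype.card H := by
    have hcard : (T.image a).card = T.card := Finset.card_image_of_injective _ a.injective
    have hdisj : Disjoint T (T.image a) := by
      rw [Finset.disjoint_left]
      intro x hx hx'
      obtain ⟨y, hy, rfl⟩ := Finset.mem_image.1 hx'
      simp only [T, Finset.mem_filter, Finset.mem_univ, true_and, ha] at hx hy
      exact lt_asymm hx hy
    have := Finset.card_le_univ (T ∪ T.image a)
    rw [Finset.card_union_of_disjoint hdisj, hcard] at this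
    omega
  have hle : finrank ℚ (invariantFunctions a) ≤ finrank ℚ (T → ℚ) := by
    refine LinearMap.finrank_le_finrank_of_injective
      (f := (LinearMap.funLeft ℚ ℚ (Subtype.val : T → H)).comp
        (invariantFunctions a).subtype) ?_
    rw [injective_iff_map_eq_zero]
    rintro ⟨f, hf⟩ h0
    have hz : ∀ h, i h < i (a h) → f h = 0 := fun h hh =>
      congrFun h0 ⟨h, by simp [T, hh]⟩
    ext h
    rcases lt_trichotomy (i h) (i (a h)) with hh | hh | hh
    · exact hz h hh
    · exact absurd (i.injective hh).symm (ha' h)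
    · have := hz (a h) (by rwa [ha])
      rwa [hf h] at this
  rw [finrank_fintype_fun_eq_card, Fintype.card_coe] at hle
  omega

lemma pairOrbits_mk_left {H : Type*} (a b : Equiv.Perm H) (h : H) :
    (Quotient.mk'' (a h) : PairOrbits a b) = Quotient.mk'' h :=
  Quotient.sound (MulAction.mem_orbit_iff.2
    ⟨⟨a, Subgroup.subset_closure (by simp)⟩, rfl⟩)

lemma pairOrbits_mk_right {H : Type*} (a b : Equiv.Perm H) (h : H) :
    (Quotient.mk'' (b h) : PairOrbits a b) = Quotient.mk'' h :=
  Quotient.sound (MulAction.mem_orbit_iff.2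
    ⟨⟨b, Subgroup.subset_closure (by simp)⟩, rfl⟩)

/-- A property preserved by the generators of a transitive group holds everywhere as soon as
it holds at one point. -/
lemma forall_of_isPretransitive_closure {H : Type*} [Finite H] {S : Set (Equiv.Perm H)}
    (hS : MulAction.IsPretransitive (Subgroup.closure S : Subgroup (Equiv.Perm H)) H)
    {P : H → Prop} (hP : ∀ s ∈ S, ∀ h, P (s h) ↔ P h) {h₀ : H} (h0 : P h₀) (h : H) : P h := by
  have key : ∀ g ∈ Subgroup.closure S, ∀ h, P (g h) ↔ P h := by
    intro g hg
    induction hg using Subgroup.closure_induction with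
    | mem x hx => exact hP x hx
    | one => simp
    | mul x y _ _ hx hy => intro h; rw [Equiv.Perm.mul_apply, hx, hy]
    | inv x _ hx => intro h; rw [← hx (x⁻¹ h)]; simp
  obtain ⟨g, rfl⟩ := hS.exists_smul_eq h₀ h
  exact (key g g.2 h₀).2 h0

/-- **Euler's inequality** for the closed surface encoded by three fixed-point-free involutions
generating a transitive group. -/
lemma card_pairOrbits_le {H : Type*} [Fintype H] [Nonempty H] (a b e : Equiv.Perm H)
    (ha : ∀ h, a (a h) = h) (hb : ∀ h, b (b h) = h) (he : ∀ h, e (e h) = h)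
    (ha' : ∀ h, a h ≠ h) (hb' : ∀ h, b h ≠ h) (he' : ∀ h, e h ≠ h)
    (htrans : MulAction.IsPretransitive
      (Subgroup.closure {a, b, e} : Subgroup (Equiv.Perm H)) H) :
    2 * (Nat.card (PairOrbits a b) + Nat.card (PairOrbits e a) + Nat.card (PairOrbits e b)) ≤
      Fintype.card H + 2 + 2 * finrank ℚ (antiInvariantFunctions a b e) := by
  classical
  have : Fintype (PairOrbits a b) := Fintype.ofFinite _
  have : Fintype (PairOrbits e a) := Fintype.ofFinite _
  have : Fintype (PairOrbits e b) := Fintype.ofFinite _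
  let bdry : ((PairOrbits a b → ℚ) × (PairOrbits e a → ℚ) × (PairOrbits e b → ℚ)) →ₗ[ℚ]
      invariantFunctions a × invariantFunctions b × invariantFunctions e :=
    { toFun := fun x =>
        (⟨fun h => x.1 (Quotient.mk'' h) - x.2.1 (Quotient.mk'' h), fun h => by
            simp only [pairOrbits_mk_left, pairOrbits_mk_right]⟩,
         ⟨fun h => x.2.2 (Quotient.mk'' h) - x.1 (Quotient.mk'' h), fun h => by
            simp only [pairOrbits_mk_right]⟩,
         ⟨fun h => x.2.1 (Quotient.mk'' h) - x.2.2 (Quotient.mk'' h), fun h => by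
            simp only [pairOrbits_mk_left]⟩)
      map_add' := fun x y => by
        ext h <;> simp <;> ring
      map_smul' := fun c x => by
        ext h <;> simp <;> ring }
  let total : (invariantFunctions a × invariantFunctions b × invariantFunctions e) →ₗ[ℚ]
      (H → ℚ) :=
    (invariantFunctions a).subtype.coprod
      ((invariantFunctions b).subtype.coprod (invariantFunctions e).subtype)
  have hrange : LinearMap.range bdry ≤ LinearMap.ker total := by
    rintro _ ⟨x, rfl⟩
    rw [LinearMap.mem_ker]
    ext h
    simp [total, bdry]
  have hker : finrank ℚ (LinearMap.ker bdry) ≤ 1 := by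
    obtain ⟨h₀⟩ := ‹Nonempty H›
    have hle : finrank ℚ (LinearMap.ker bdry) ≤ finrank ℚ ℚ := by
      refine LinearMap.finrank_le_finrank_of_injective
        (f := ((LinearMap.proj (Quotient.mk'' h₀)).comp
          (LinearMap.fst ℚ (PairOrbits a b → ℚ) _)).comp (LinearMap.ker bdry).subtype) ?_
      rw [injective_iff_map_eq_zero]
      rintro ⟨⟨p, q, r⟩, hx⟩ h0
      rw [LinearMap.mem_ker] at hx
      have hpq : ∀ h, p (Quotient.mk'' h) = q (Quotient.mk'' h) := fun h =>
        sub_eq_zero.1 (congrFun (congrArg (fun y => (y.1 : H → ℚ)) hx) h)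
      have hrp : ∀ h, r (Quotient.mk'' h) = p (Quotient.mk'' h) := fun h =>
        sub_eq_zero.1 (congrFun (congrArg (fun y => (y.2.1 : H → ℚ)) hx) h)
      have hp : ∀ h, p (Quotient.mk'' h) = 0 := by
        refine forall_of_isPretransitive_closure htrans ?_ (h₀ := h₀) h0
        rintro s (rfl | rfl | rfl) h
        · rw [pairOrbits_mk_left]
        · rw [pairOrbits_mk_right]
        · rw [hpq, hpq, pairOrbits_mk_left]
      have hp0 : p = 0 := funext fun o => Quotient.inductionOn' o hp
      have hq0 : q = 0 := funext fun o => Quotient.inductionOn' o fun h => (hpq h) ▸ hp h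
      have hr0 : r = 0 := funext fun o => Quotient.inductionOn' o fun h => (hrp h).trans (hp h)
      simp [hp0, hq0, hr0]
    simpa using hle
  have hann : finrank ℚ (LinearMap.range total).dualAnnihilator ≤
      finrank ℚ (antiInvariantFunctions a b e) := by
    have hedge : ∀ (s : Equiv.Perm H), (∀ h, s (s h) = h) →
        ∀ h, (Pi.single h 1 + Pi.single (s h) 1 : H → ℚ) ∈ invariantFunctions s := by
      intro s hs h k
      have h1 : s k = h ↔ k = s h := ⟨fun hk => by rw [← hk, hs], fun hk => by rw [hk, hs]⟩
      have h2 : s k = s h ↔ k = h := s.injective.eq_iff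
      simp only [Pi.add_apply, Pi.single_apply, h1, h2]
      ring
    have hvanish : ∀ φ : (LinearMap.range total).dualAnnihilator, ∀ h,
        φ.1 (Pi.single (a h) 1) = -φ.1 (Pi.single h 1) ∧
        φ.1 (Pi.single (b h) 1) = -φ.1 (Pi.single h 1) ∧
        φ.1 (Pi.single (e h) 1) = -φ.1 (Pi.single h 1) := by
      rintro ⟨φ, hφ⟩ h
      rw [Submodule.mem_dualAnnihilator] at hφ
      have h1 := hφ _ ⟨(⟨_, hedge a ha h⟩, 0, 0), rfl⟩
      have h2 := hφ _ ⟨(0, ⟨_, hedge b hb h⟩, 0), rfl⟩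
      have h3 := hφ _ ⟨(0, 0, ⟨_, hedge e he h⟩), rfl⟩
      simp only [total, LinearMap.coprod_apply, Submodule.subtype_apply, map_add, map_zero,
        add_zero, zero_add] at h1 h2 h3
      refine ⟨?_, ?_, ?_⟩ <;> linarith
    let ev : (LinearMap.range total).dualAnnihilator →ₗ[ℚ] antiInvariantFunctions a b e :=
      { toFun := fun φ => ⟨fun h => φ.1 (Pi.single h 1), hvanish φ⟩
        map_add' := fun φ ψ => rfl
        map_smul' := fun c φ => rfl }
    refine LinearMap.finrank_le_finrank_of_injective (f := ev) ?_
    rw [injective_iff_map_eq_zero]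
    rintro φ h0
    have h1 : ∀ h, φ.1 (Pi.single h 1) = 0 := fun h =>
      congrFun (congrArg Subtype.val h0) h
    apply Subtype.ext
    refine LinearMap.pi_ext' fun h => LinearMap.ext_ring ?_
    simpa using h1 h
  have e1 := LinearMap.finrank_range_add_finrank_ker bdry
  have e2 := LinearMap.finrank_range_add_finrank_ker total
  have e3 := Submodule.finrank_mono hrange
  have e4 := Subspace.finrank_add_finrank_dualAnnihilator_eq (LinearMap.range total)
  have e5 := two_mul_finrank_invariantFunctions_le a ha ha'
  have e6 := two_mul_finrank_invariantFunctions_le b hb hb'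
  have e7 := two_mul_finrank_invariantFunctions_le e he he'
  simp only [Module.finrank_prod, finrank_fintype_fun_eq_card] at e1 e2 e4
  simp only [Nat.card_eq_fintype_card]
  omega

lemma antiInvariantFunctions_eq_zero {H : Type*} [Finite H] {a b e : Equiv.Perm H}
    (htrans : MulAction.IsPretransitive
      (Subgroup.closure {a, b, e} : Subgroup (Equiv.Perm H)) H)
    {f : H → ℚ} (hf : f ∈ antiInvariantFunctions a b e) {h₀ : H} (h0 : f h₀ = 0) : f = 0 := by
  funext h
  refine forall_of_isPretransitive_closure (P := fun h => f h = 0) htrans ?_ h0 h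
  rintro s (rfl | rfl | rfl) h
  · simp [(hf h).1]
  · simp [(hf h).2.1]
  · simp [(hf h).2.2]

lemma finrank_antiInvariantFunctions_le_one {H : Type*} [Finite H] [Nonempty H]
    {a b e : Equiv.Perm H}
    (htrans : MulAction.IsPretransitive
      (Subgroup.closure {a, b, e} : Subgroup (Equiv.Perm H)) H) :
    finrank ℚ (antiInvariantFunctions a b e) ≤ 1 := by
  obtain ⟨h₀⟩ := ‹Nonempty H›
  have hle : finrank ℚ (antiInvariantFunctions a b e) ≤ finrank ℚ ℚ := by
    refine LinearMap.finrank_le_finrank_of_injective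
      (f := (LinearMap.proj h₀).comp (antiInvariantFunctions a b e).subtype) ?_
    rw [injective_iff_map_eq_zero]
    rintro ⟨f, hf⟩ h0
    exact Subtype.ext (antiInvariantFunctions_eq_zero htrans hf h0)
  simpa using hle

lemma finrank_antiInvariantFunctions_eq_zero {H : Type*} [Finite H]
    {a b e : Equiv.Perm H}
    (htrans : MulAction.IsPretransitive
      (Subgroup.closure {a, b, e} : Subgroup (Equiv.Perm H)) H)
    {h₀ : H} (h : e h₀ = a (b h₀)) :
    finrank ℚ (antiInvariantFunctions a b e) = 0 := by
  suffices antiInvariantFunctions a b e = ⊥ by rw [this, finrank_bot]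
  rw [Submodule.eq_bot_iff]
  intro f hf
  refine antiInvariantFunctions_eq_zero htrans hf (h₀ := h₀) ?_
  have h1 := (hf h₀).2.2
  rw [h, (hf (b h₀)).1, (hf h₀).2.1] at h1
  linarith

/-- In a tetrahedral graph, the product of two of the pairings is the third one. -/
lemma tetrahedral_mul_apply {H B ι : Type*} [Finite H] (blk : H → B)
    (hblk : ∀ b, Nat.card {h : H // blk h = b} = 4)
    (π : ι → Equiv.Perm H) (hπ : ∀ c h, π c (π c h) = h) (hπfpf : ∀ c h, π c h ≠ h)
    (hπblk : ∀ c h, blk (π c h) = blk h)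
    (htetra : ∀ (b : B) (c c' : ι), c ≠ c' → ∃ h, blk h = b ∧ π c h ≠ π c' h)
    {c c' c'' : ι} (h₁ : c ≠ c') (h₂ : c' ≠ c'') (h₃ : c ≠ c'') (h : H) :
    π c (π c' h) = π c'' h := by
  classical
  have := Fintype.ofFinite H
  have hfour : ∀ x y z w v : H, blk y = blk x → blk z = blk x → blk w = blk x →
      blk v = blk x → x ≠ y → x ≠ z → x ≠ w → y ≠ z → y ≠ w → z ≠ w →
      v = x ∨ v = y ∨ v = z ∨ v = w := by
    intro x y z w v hy hz hw hv hxy hxz hxw hyz hyw hzw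
    have hcard : (Finset.univ.filter fun k => blk k = blk x).card = 4 := by
      rw [← hblk (blk x), Nat.card_eq_fintype_card, Fintype.card_subtype]
    have hsub : ({x, y, z, w} : Finset H) ⊆ Finset.univ.filter fun k => blk k = blk x := by
      intro k hk
      simp only [Finset.mem_insert, Finset.mem_singleton] at hk
      rcases hk with rfl | rfl | rfl | rfl <;> simp [*]
    have heq := Finset.eq_of_subset_of_card_le hsub (by
      rw [hcard, Finset.card_insert_of_notMem (by simp [*]),
        Finset.card_insert_of_notMem (by simp [*]), Finset.card_pair hzw])
    have : v ∈ ({x, y, z, w} : Finset H) := by rw [heq]; simp [hv]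
    simpa using this
  have hne : ∀ d d' : ι, d ≠ d' → ∀ k, π d k ≠ π d' k := by
    intro d d' hd k hk
    obtain ⟨x, hx, hx'⟩ := htetra (blk k) d d' hd
    have hxk : x ≠ k := by rintro rfl; exact hx' hk
    have hxk' : x ≠ π d k := by
      rintro rfl
      apply hx'
      rw [hπ, hk, hπ]
    have h4 := hfour k (π d k) x (π d x) (π d' x) (hπblk _ _) hx
      (by rw [hπblk, hx]) (by rw [hπblk, hx]) (hπfpf d k).symm hxk.symm
      (fun he => hxk' (by rw [he, hπ])) hxk'.symm
      (fun he => hxk ((π d).injective he).symm) (hπfpf d x).symm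
    rcases h4 with h4 | h4 | h4 | h4
    · exact hxk' (by rw [hk, ← h4, hπ])
    · exact hxk ((π d').injective (h4.trans hk))
    · exact hπfpf d' x h4
    · exact hx' h4.symm
  rcases hfour h (π c h) (π c' h) (π c'' h) (π c (π c' h)) (hπblk _ _) (hπblk _ _)
    (hπblk _ _) (by rw [hπblk, hπblk]) (hπfpf c h).symm (hπfpf c' h).symm
    (hπfpf c'' h).symm (hne _ _ h₁ h) (hne _ _ h₃ h) (hne _ _ h₂ h) with h4 | h4 | h4 | h4
  · exact absurd (by rw [← h4, hπ, h4]) (hne _ _ h₁ h)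
  · exact absurd ((π c).injective h4) (hπfpf c' h)
  · exact absurd h4 (hπfpf c (π c' h))
  · exact h4

/-- **A face of length one costs at least half a unit of CTKT degree.**  Let
`(H, blk, ε, π)` be a connected CTKT stranded graph all of whose vertices (4-element
blocks) are tetrahedral, with `V_t` vertices and `F` total faces.  If the graph has a
face of length one, i.e. there is a half-edge `h` and a color `c` with `ε h = π c h`,
then `2·F ≤ 5 + 3·V_t`, i.e. the CTKT degree `ω = 3 + (3/2)·V_t - F` satisfies
`ω ≥ 1/2`. -/
theorem ctkt_face_length_one_degree_bound
    (H : Type) [Fintype H] [Nonempty H]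
    (B : Type) [Fintype B] (blk : H → B)
    (hblk : ∀ b, Nat.card {h : H // blk h = b} = 4)
    (ε : Equiv.Perm H) (hε : ε * ε = 1) (hε' : ∀ h, ε h ≠ h)
    (π : Fin 3 → Equiv.Perm H)
    (hπinv : ∀ c, π c * π c = 1) (hπfpf : ∀ c h, π c h ≠ h)
    (hπblk : ∀ c h, blk (π c h) = blk h)
    (hconn : MulAction.IsPretransitive
      (Subgroup.closure ({ε} ∪ Set.range π) : Subgroup (Equiv.Perm H)) H)
    (htetra : ∀ (b : B) (c c' : Fin 3), c ≠ c' →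
      ∃ h, blk h = b ∧ π c h ≠ π c' h)
    (Vt F : ℕ)
    (hVt : Vt = Nat.card B)
    (hF : F = ∑ c : Fin 3, Nat.card (MulAction.orbitRel.Quotient
        (Subgroup.closure {ε, π c} : Subgroup (Equiv.Perm H)) H))
    (hone : ∃ (h : H) (c : Fin 3), ε h = π c h) :
    2 * F ≤ 5 + 3 * Vt := by
  classical
  have hπ : ∀ c h, π c (π c h) = h := fun c h => by
    rw [← Equiv.Perm.mul_apply, hπinv, Equiv.Perm.one_apply]
  have hεε : ∀ h, ε (ε h) = h := fun h => by
    rw [← Equiv.Perm.mul_apply, hε, Equiv.Perm.one_apply]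
  have hmul := fun {c c' c'' : Fin 3} => tetrahedral_mul_apply blk hblk π hπ hπfpf hπblk htetra
    (c := c) (c' := c') (c'' := c'')
  have hcardH : Fintype.card H = 4 * Vt := by
    rw [hVt, Nat.card_eq_fintype_card, ← Fintype.card_congr (Equiv.sigmaFiberEquiv blk),
      Fintype.card_sigma]
    simp only [← Nat.card_eq_fintype_card, hblk]
    simp [mul_comm]
  have htrans : ∀ c c' c'' : Fin 3, c ≠ c' → c' ≠ c'' → c ≠ c'' →
      MulAction.IsPretransitive
        (Subgroup.closure {π c, π c', ε} : Subgroup (Equiv.Perm H)) H := by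
    intro c c' c'' h₁ h₂ h₃
    have hle : Subgroup.closure ({ε} ∪ Set.range π) ≤ Subgroup.closure {π c, π c', ε} := by
      rw [Subgroup.closure_le]
      have hc : π c ∈ Subgroup.closure {π c, π c', ε} := Subgroup.subset_closure (by simp)
      have hc' : π c' ∈ Subgroup.closure {π c, π c', ε} := Subgroup.subset_closure (by simp)
      rintro _ (rfl | ⟨d, rfl⟩)
      · exact Subgroup.subset_closure (by simp)
      · have hd : d = c ∨ d = c' ∨ d = c'' := by omega
        rcases hd with rfl | rfl | rfl
        · exact hc
        · exact hc'
        · have : π d = π c * π c' := Equiv.ext fun h => (hmul h₁ h₂ h₃ h).symm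
          rw [this]
          exact mul_mem hc hc'
    refine ⟨fun x y => ?_⟩
    obtain ⟨g, hg⟩ := hconn.exists_smul_eq x y
    exact ⟨⟨g, hle g.2⟩, hg⟩
  have hblkcard : ∀ c c' : Fin 3, Vt ≤ Nat.card (PairOrbits (π c) (π c')) := by
    intro c c'
    have hinv : ∀ g ∈ Subgroup.closure {π c, π c'}, ∀ h, blk (g h) = blk h := by
      intro g hg
      induction hg using Subgroup.closure_induction with
      | mem x hx => rcases hx with rfl | rfl <;> exact hπblk _
      | one => simp
      | mul x y _ _ hx hy => intro h; rw [Equiv.Perm.mul_apply, hx, hy]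
      | inv x _ hx => intro h; rw [← hx (x⁻¹ h)]; simp
    rw [hVt]
    refine Nat.card_le_card_of_surjective
      (fun o : PairOrbits (π c) (π c') => Quotient.liftOn' o blk ?_) ?_
    · rintro x y ⟨g, rfl⟩
      exact hinv g g.2 y
    · intro b
      have : Nonempty {h : H // blk h = b} :=
        (Nat.card_pos_iff.1 (by rw [hblk b]; norm_num)).1
      obtain ⟨h, rfl⟩ := this
      exact ⟨Quotient.mk'' h, rfl⟩
  have hpair : ∀ c c' c'' : Fin 3, c ≠ c' → c' ≠ c'' → c ≠ c'' →
      Nat.card (PairOrbits ε (π c)) + Nat.card (PairOrbits ε (π c')) ≤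
        Vt + 1 + finrank ℚ (antiInvariantFunctions (π c) (π c') ε) := by
    intro c c' c'' h₁ h₂ h₃
    have := card_pairOrbits_le (π c) (π c') ε (hπ c) (hπ c') hεε (hπfpf c) (hπfpf c') hε'
      (htrans c c' c'' h₁ h₂ h₃)
    have := hblkcard c c'
    omega
  have hone_le : ∀ c c' c'' : Fin 3, c ≠ c' → c' ≠ c'' → c ≠ c'' →
      finrank ℚ (antiInvariantFunctions (π c) (π c') ε) ≤ 1 := fun c c' c'' h₁ h₂ h₃ =>
    finrank_antiInvariantFunctions_le_one (htrans c c' c'' h₁ h₂ h₃)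
  obtain ⟨h₀, c, hc⟩ := hone
  have hzero : ∀ c' c'' : Fin 3, c' ≠ c'' → c'' ≠ c → c' ≠ c →
      finrank ℚ (antiInvariantFunctions (π c') (π c'') ε) = 0 := fun c' c'' h₁ h₂ h₃ =>
    finrank_antiInvariantFunctions_eq_zero (htrans c' c'' c h₁ h₂ h₃)
      (hc.trans (hmul h₁ h₂ h₃ h₀).symm)
  change F = ∑ c, Nat.card (PairOrbits ε (π c)) at hF
  rw [Fin.sum_univ_three] at hF
  have p01 := hpair 0 1 2 (by decide) (by decide) (by decide)
  have p12 := hpair 1 2 0 (by decide) (by decide) (by decide)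
  have p02 := hpair 0 2 1 (by decide) (by decide) (by decide)
  have q01 := hone_le 0 1 2 (by decide) (by decide) (by decide)
  have q12 := hone_le 1 2 0 (by decide) (by decide) (by decide)
  have q02 := hone_le 0 2 1 (by decide) (by decide) (by decide)
  have hc3 : c = 0 ∨ c = 1 ∨ c = 2 := by omega
  rcases hc3 with rfl | rfl | rfl
  · have := hzero 1 2 (by decide) (by decide) (by decide)
    omega
  · have := hzero 0 2 (by decide) (by decide) (by decide)
    omega
  · have := hzero 0 1 (by decide) (by decide) (by decide)
    omega
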